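/- A compact set X in C^n is a Poisson set if and only if for every z in X the set J_z^b(X) contains exactly one measure. -/

import Mathlib

open MeasureTheory Metric Filter Topology Set Complex
open scoped ENNReal

noncomputable section

/-- `ℂⁿ`. -/
abbrev En (n : ℕ) : Type := EuclideanSpace ℂ (Fin n)

instance (n : ℕ) : MeasurableSpace (En n) := borel _

instance (n : ℕ) : BorelSpace (En n) := ⟨rfl⟩

open Classical in
/-- The positive part of an extended real number, as an element of `ℝ≥0∞`. -/
def epos (x : EReal) : ℝ≥0∞ := if x = ⊤ then ⊤ else ENNReal.ofReal x.toReal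

/-- The integral of an `EReal`-valued function `u` against a measure `μ`, defined as the
difference of the lower integrals of the positive and negative parts of `u`. -/
def eint {α : Type*} [MeasurableSpace α] (μ : Measure α) (u : α → EReal) : EReal :=
  ((∫⁻ x, epos (u x) ∂μ : ℝ≥0∞) : EReal) - ((∫⁻ x, epos (-(u x)) ∂μ : ℝ≥0∞) : EReal)

/-- The normalized angular measure `(2π)⁻¹ dθ` on `[0, 2π)`. -/
def thetaM : Measure ℝ :=
  (ENNReal.ofReal ((2 * Real.pi)⁻¹)) • (volume.restrict (Set.Ico (0 : ℝ) (2 * Real.pi)))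

/-- A function `u` with values in `[-∞, ∞)` is plurisubharmonic on an open set `U ⊆ ℂⁿ`:
it is upper semicontinuous, `< ⊤`, and satisfies the sub-mean-value inequality on every
complex line. -/
def PshOnE {n : ℕ} (u : En n → EReal) (U : Set (En n)) : Prop :=
  UpperSemicontinuousOn u U ∧ (∀ z ∈ U, u z < ⊤) ∧
  ∀ z ∈ U, ∀ w : En n, ∀ r : ℝ, 0 < r →
    (∀ ζ : ℂ, ‖ζ‖ ≤ r → z + ζ • w ∈ U) →
    u z ≤ eint thetaM (fun θ => u (z + (circleMap 0 r θ) • w))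

/-- `μ` is a Jensen measure on `X` with barycenter `z`:  a Borel probability measure
supported on `X` such that `u z ≤ ∫ u dμ` for every function `u` continuous and
plurisubharmonic on some open neighborhood of `X`. -/
def IsJensen {n : ℕ} (X : Set (En n)) (z : En n) (μ : Measure (En n)) : Prop :=
  IsProbabilityMeasure μ ∧ μ Xᶜ = 0 ∧
  ∀ U : Set (En n), IsOpen U → X ⊆ U →
    ∀ u : En n → EReal, ContinuousOn u U → PshOnE u U → u z ≤ eint μ u

/-- `u : X → [-∞, ∞)` is plurisubharmonic on the compact set `X` : it is upper
semicontinuous on `X`, `< ⊤` on `X`, and satisfies the subaveraging inequality with respect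
to all Jensen measures on `X`. -/
def PSHe {n : ℕ} (X : Set (En n)) (u : En n → EReal) : Prop :=
  UpperSemicontinuousOn u X ∧ (∀ z ∈ X, u z < ⊤) ∧
  ∀ z ∈ X, ∀ μ : Measure (En n), IsJensen X z μ → u z ≤ eint μ u

/-- `PSH^c(X)`: continuous plurisubharmonic functions on `X`. -/
def PSHce {n : ℕ} (X : Set (En n)) (u : En n → EReal) : Prop :=
  PSHe X u ∧ ContinuousOn u X

/-- Real-valued continuous plurisubharmonic functions on `X`. -/
def PSHcR {n : ℕ} (X : Set (En n)) (u : En n → ℝ) : Prop :=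
  ContinuousOn u X ∧ PSHe X (fun x => (u x : EReal))

/-- `O_X`: the set of points `z ∈ X` whose only Jensen measure is `δ_z`. -/
def Oset {n : ℕ} (X : Set (En n)) : Set (En n) :=
  {z | z ∈ X ∧ ∀ μ : Measure (En n), IsJensen X z μ → μ = Measure.dirac z}

/-- The potential boundary `B_X`, the closure of `O_X`. -/
def Bset {n : ℕ} (X : Set (En n)) : Set (En n) := closure (Oset X)

/-- `J^b_z(X)`: Jensen measures with barycenter `z` supported on `B_X`. -/
def IsJensenB {n : ℕ} (X : Set (En n)) (z : En n) (μ : Measure (En n)) : Prop :=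
  IsJensen X z μ ∧ μ (Bset X)ᶜ = 0

/-- `ν` is subordinated to `μ` : `μ(u) ≥ ν(u)` for all `u ∈ PSH^c(X)`. -/
def Subord {n : ℕ} (X : Set (En n)) (μ ν : Measure (En n)) : Prop :=
  ∀ u : En n → EReal, PSHce X u → eint ν u ≤ eint μ u

/-- Subharmonic functions with values in `[-∞, ∞)` on an open set `U ⊆ ℂ`. -/
def SubharmOn (u : ℂ → EReal) (U : Set ℂ) : Prop :=
  UpperSemicontinuousOn u U ∧ (∀ z ∈ U, u z < ⊤) ∧
  ∀ z ∈ U, ∀ r : ℝ, 0 < r → closedBall z r ⊆ U →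
    u z ≤ eint thetaM (fun θ => u (circleMap z r θ))

/-- Harmonic (real-valued) functions on an open set `U ⊆ ℂ`: continuous functions
satisfying the mean-value equality. -/
def HarmOn (h : ℂ → ℝ) (U : Set ℂ) : Prop :=
  ContinuousOn h U ∧
  ∀ z ∈ U, ∀ r : ℝ, 0 < r → closedBall z r ⊆ U →
    h z = (2 * Real.pi)⁻¹ * ∫ θ in (0 : ℝ)..(2 * Real.pi), h (circleMap z r θ)

/-- Superharmonic (real-valued) functions on an open set `U ⊆ ℂ`. -/
def SuperharmOn (v : ℂ → ℝ) (U : Set ℂ) : Prop :=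
  LowerSemicontinuousOn v U ∧
  ∀ z ∈ U, ∀ r : ℝ, 0 < r → closedBall z r ⊆ U →
    (2 * Real.pi)⁻¹ * (∫ θ in (0 : ℝ)..(2 * Real.pi), v (circleMap z r θ)) ≤ v z

/-- The infimum of all positive superharmonic functions on the unit disk, extending
continuously to the closed disk and `≥ 1` on `A`, evaluated at `z`. -/
def hmPre (A : Set ℂ) (z : ℂ) : ℝ :=
  sInf {t : ℝ | ∃ v : ℂ → ℝ, SuperharmOn v (ball 0 1) ∧ (∀ w ∈ ball (0 : ℂ) 1, 0 < v w) ∧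
    ContinuousOn v (closedBall 0 1) ∧ (∀ w ∈ A, 1 ≤ v w) ∧ t = v z}

/-- The harmonic measure `ω(z, A, 𝔻)` of `A` with respect to the unit disk. -/
def hm (z : ℂ) (A : Set ℂ) : ℝ := Filter.liminf (fun w => hmPre A w) (𝓝 z)

open Classical in
/-- The radial limit of a map `f` at the boundary point `ζ` of the unit circle
(junk value `0` if the radial limit does not exist). -/
def bval {n : ℕ} (f : ℂ → En n) (ζ : ℂ) : En n :=
  if h : ∃ l : En n, Tendsto (fun r : ℝ => f ((r : ℂ) * ζ)) (𝓝[<] (1 : ℝ)) (𝓝 l)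
  then h.choose else 0

open Classical in
/-- The radial limit of an `EReal`-valued function on the disk at the boundary point `ζ`. -/
def bvalE (g : ℂ → EReal) (ζ : ℂ) : EReal :=
  if h : ∃ l : EReal, Tendsto (fun r : ℝ => g ((r : ℂ) * ζ)) (𝓝[<] (1 : ℝ)) (𝓝 l)
  then h.choose else 0

/-- `μ_f`: the push-forward of the normalized arclength measure on the unit circle under the
radial boundary values of `f`. -/
def bmeas {n : ℕ} (f : ℂ → En n) : Measure (En n) :=
  thetaM.map (fun θ => bval f (circleMap 0 1 θ))

/-- Weak-* convergence of a sequence of measures on `ℂⁿ`. -/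
def WeakConv {n : ℕ} (μs : ℕ → Measure (En n)) (μ : Measure (En n)) : Prop :=
  ∀ φ : BoundedContinuousFunction (En n) ℝ,
    Tendsto (fun j => ∫ x, φ x ∂(μs j)) atTop (𝓝 (∫ x, φ x ∂μ))

/-- The cluster set `cl L` of a sequence of maps of the unit disk into `ℂⁿ`. -/
def clusterSet {n : ℕ} (f : ℕ → ℂ → En n) : Set (En n) :=
  {z | ∀ r : ℝ, 0 < r → ∀ N : ℕ, ∃ j, N ≤ j ∧ ∃ ζ ∈ ball (0 : ℂ) 1, f j ζ ∈ ball z r}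

/-- A point `z` is totally essential for the sequence `f` if for every open set `V ∋ z` the
harmonic measures at `0` of `f j ⁻¹' V` stay bounded away from `0`. -/
def TotallyEssential {n : ℕ} (f : ℕ → ℂ → En n) (z : En n) : Prop :=
  ∀ V : Set (En n), IsOpen V → z ∈ V →
    0 < Filter.atTop.liminf (fun j => hm 0 ((f j ⁻¹' V) ∩ ball 0 1))

/-- A totally perfect sequence `L` of holomorphic maps of the unit disk into `ℂⁿ`: a
uniformly bounded sequence of holomorphic maps which is weak-* converging (with limit measure
`μ_L` and center `z_L`) and all of whose cluster points are totally essential. -/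
structure PerfectSeq (n : ℕ) where
  f : ℕ → ℂ → En n
  holo : ∀ j, DifferentiableOn ℂ (f j) (ball 0 1)
  bdd : ∃ C : ℝ, ∀ j, ∀ ζ ∈ ball (0 : ℂ) 1, ‖f j ζ‖ ≤ C
  μL : Measure (En n)
  conv : WeakConv (fun j => bmeas (f j)) μL
  zL : En n
  center : Tendsto (fun j => f j 0) atTop (𝓝 zL)
  ess : ∀ z ∈ clusterSet f, TotallyEssential f z

/-- `J_z^s(L)`: the measures obtained as weak-* limits of `μ_{f_{j_k} ∘ g_k}` for subsequences
`{j_k}` and holomorphic maps `g_k : 𝔻 → 𝔻` with `f_{j_k}(g_k(0)) → z`. -/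
def JsSet {n : ℕ} (L : PerfectSeq n) (z : En n) : Set (Measure (En n)) :=
  {μ | ∃ jk : ℕ → ℕ, StrictMono jk ∧ ∃ g : ℕ → ℂ → ℂ,
    (∀ k, DifferentiableOn ℂ (g k) (ball 0 1) ∧ MapsTo (g k) (ball 0 1) (ball 0 1)) ∧
    WeakConv (fun k => bmeas ((L.f (jk k)) ∘ (g k))) μ ∧
    Tendsto (fun k => L.f (jk k) (g k 0)) atTop (𝓝 z)}

/-- `J_z(L)`: the convex hull of `J_z^s(L)`. -/
def JLSet {n : ℕ} (L : PerfectSeq n) (z : En n) : Set (Measure (En n)) :=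
  {μ | ∃ (m : ℕ) (w : Fin m → ℝ) (ν : Fin m → Measure (En n)),
    (∀ i, 0 ≤ w i) ∧ (∑ i, w i = 1) ∧ (∀ i, ν i ∈ JsSet L z) ∧
    μ = ∑ i, (ENNReal.ofReal (w i)) • ν i}

/-- `u` is harmonic on the totally perfect sequence `L`. -/
def HarmonicOnL {n : ℕ} (L : PerfectSeq n) (u : En n → EReal) : Prop :=
  PSHce (clusterSet L.f) u ∧
  ∀ z ∈ clusterSet L.f, ∀ μ ∈ JLSet L z, eint μ u = u z

/-- `PSH^w(X)`: weakly plurisubharmonic functions, the upper envelopes of nonempty families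
of continuous plurisubharmonic functions on `X`. -/
def PSHw {n : ℕ} (X : Set (En n)) (u : En n → EReal) : Prop :=
  ∃ F : Set (En n → EReal), F.Nonempty ∧ (∀ v ∈ F, PSHce X v) ∧
    ∀ x ∈ X, u x = ⨆ v ∈ F, v x

/-- `u` is maximal on `X ∖ Z`: for every relatively open `V ⊆ X ∖ Z` and every
`v ∈ PSH^c(closure V)`, if `v ≤ u` on the relative boundary of `V` in `X` then `v ≤ u`
on `closure V`. -/
def MaximalOn {n : ℕ} (X Z : Set (En n)) (u : En n → EReal) : Prop :=
  ∀ W : Set (En n), IsOpen W → X ∩ W ⊆ X \ Z →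
    ∀ v : En n → EReal, PSHce (closure (X ∩ W)) v →
      (∀ x ∈ closure (X ∩ W) \ (X ∩ W), v x ≤ u x) →
      ∀ x ∈ closure (X ∩ W), v x ≤ u x

/-- Pluriharmonic continuous real-valued functions on `X`. -/
def Pluriharm {n : ℕ} (X : Set (En n)) (h : En n → ℝ) : Prop :=
  ContinuousOn h X ∧
  ∀ z ∈ X, ∀ μ : Measure (En n), IsJensen X z μ → (h z : EReal) = eint μ (fun x => (h x : EReal))

/-- `X` is a Poisson set: every continuous real-valued function on `B_X` extends to a
pluriharmonic function on `X`. -/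
def PoissonSet {n : ℕ} (X : Set (En n)) : Prop :=
  ∀ φ : En n → ℝ, ContinuousOn φ (Bset X) →
    ∃ h : En n → ℝ, Pluriharm X h ∧ ∀ w ∈ Bset X, h w = φ w

end

lemma epos_eq_toENNReal (x : EReal) : epos x = x.toENNReal := rfl

lemma eint_mono {α : Type*} [MeasurableSpace α] {μ : Measure α} {u v : α → EReal}
    (h : ∀ᵐ x ∂μ, u x ≤ v x) : eint μ u ≤ eint μ v := by
  refine EReal.sub_le_sub ?_ ?_ <;> refine EReal.coe_ennreal_le_coe_ennreal_iff.2 ?_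
  · exact lintegral_mono_ae (h.mono fun x hx => EReal.toENNReal_le_toENNReal hx)
  · exact lintegral_mono_ae
      (h.mono fun x hx => EReal.toENNReal_le_toENNReal (EReal.neg_le_neg_iff.2 hx))

lemma eint_coe {α : Type*} [MeasurableSpace α] {μ : Measure α} {f : α → ℝ}
    (hf : Integrable f μ) : eint μ (fun x => (f x : EReal)) = ((∫ x, f x ∂μ : ℝ) : EReal) := by
  rw [integral_eq_lintegral_pos_part_sub_lintegral_neg_part hf, EReal.coe_sub]
  have h1 : ∫⁻ x, ENNReal.ofReal (f x) ∂μ ≠ ⊤ := hf.lintegral_lt_top.ne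
  have h2 : ∫⁻ x, ENNReal.ofReal (-f x) ∂μ ≠ ⊤ := hf.neg.lintegral_lt_top.ne
  rw [EReal.coe_ennreal_toReal h1, EReal.coe_ennreal_toReal h2]
  rfl

instance : IsProbabilityMeasure thetaM := by
  constructor
  have : (0 : ℝ) < 2 * Real.pi := Real.two_pi_pos
  simp only [thetaM, Measure.smul_apply, Measure.restrict_apply MeasurableSet.univ,
    Set.univ_inter, Real.volume_Ico, sub_zero, smul_eq_mul]
  rw [← ENNReal.ofReal_mul (by positivity), inv_mul_cancel₀ this.ne', ENNReal.ofReal_one]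

lemma integrable_thetaM {f : ℝ → ℝ} (hf : Continuous f) : Integrable f thetaM := by
  refine Integrable.smul_measure ?_ ENNReal.ofReal_ne_top
  exact (hf.integrableOn_Icc (a := 0) (b := 2 * Real.pi)).mono_set Ico_subset_Icc_self

lemma integral_thetaM (f : ℂ → ℂ) (c : ℂ) (r : ℝ) :
    ∫ θ, f (circleMap c r θ) ∂thetaM = Real.circleAverage f c r := by
  have : (0 : ℝ) ≤ 2 * Real.pi := Real.two_pi_pos.le
  rw [Real.circleAverage_def, intervalIntegral.integral_of_le this, thetaM,
    integral_smul_measure, ENNReal.toReal_ofReal (by positivity),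
    Measure.restrict_congr_set Ico_ae_eq_Ioc]

/-- Real-valued continuous functions that are plurisubharmonic on an open neighborhood of `X`. -/
def PshNear {n : ℕ} (X : Set (En n)) (f : En n → ℝ) : Prop :=
  ∃ U : Set (En n), IsOpen U ∧ X ⊆ U ∧ ContinuousOn f U ∧
    ∀ z ∈ U, ∀ w : En n, ∀ r : ℝ, 0 < r → (∀ ζ : ℂ, ‖ζ‖ ≤ r → z + ζ • w ∈ U) →
      f z ≤ ∫ θ, f (z + circleMap 0 r θ • w) ∂thetaM

lemma continuous_comp_circleMap {n : ℕ} {β : Type*} [TopologicalSpace β] {f : En n → β}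
    {U : Set (En n)} (hf : ContinuousOn f U)
    {z w : En n} {r : ℝ} (hr : 0 < r) (h : ∀ ζ : ℂ, ‖ζ‖ ≤ r → z + ζ • w ∈ U) :
    Continuous fun θ : ℝ => f (z + circleMap 0 r θ • w) := by
  refine hf.comp_continuous ?_ fun θ => h _ ?_
  · exact continuous_const.add ((continuous_circleMap 0 r).smul continuous_const)
  · simp [abs_of_pos hr]

namespace PshNear

variable {n : ℕ} {X : Set (En n)} {f g : En n → ℝ}

lemma continuousOn (hf : PshNear X f) : ContinuousOn f X := by
  obtain ⟨U, _, hXU, hc, _⟩ := hf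
  exact hc.mono hXU

lemma const (c : ℝ) : PshNear X fun _ => c :=
  ⟨univ, isOpen_univ, subset_univ _, continuousOn_const, fun _ _ _ _ _ _ => by simp⟩

lemma add (hf : PshNear X f) (hg : PshNear X g) : PshNear X fun x => f x + g x := by
  obtain ⟨U, hU, hXU, hfc, hfm⟩ := hf
  obtain ⟨V, hV, hXV, hgc, hgm⟩ := hg
  refine ⟨U ∩ V, hU.inter hV, subset_inter hXU hXV,
    (hfc.mono inter_subset_left).add (hgc.mono inter_subset_right), fun z hz w r hr h => ?_⟩
  rw [integral_add
    (integrable_thetaM (continuous_comp_circleMap hfc hr fun ζ hζ => (h ζ hζ).1))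
    (integrable_thetaM (continuous_comp_circleMap hgc hr fun ζ hζ => (h ζ hζ).2))]
  exact add_le_add (hfm z hz.1 w r hr fun ζ hζ => (h ζ hζ).1)
    (hgm z hz.2 w r hr fun ζ hζ => (h ζ hζ).2)

lemma const_mul (hf : PshNear X f) {c : ℝ} (hc : 0 ≤ c) : PshNear X fun x => c * f x := by
  obtain ⟨U, hU, hXU, hfc, hfm⟩ := hf
  refine ⟨U, hU, hXU, continuousOn_const.mul hfc, fun z hz w r hr h => ?_⟩
  rw [integral_const_mul]
  exact mul_le_mul_of_nonneg_left (hfm z hz w r hr h) hc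

lemma re_inner (p : En n) : PshNear X fun x => (inner ℂ p x).re := by
  refine ⟨univ, isOpen_univ, subset_univ _, by fun_prop, fun z _ w r hr _ => le_of_eq ?_⟩
  have hd : DiffContOnCl ℂ (fun ζ : ℂ => inner ℂ p z + ζ * inner ℂ p w) (ball 0 |r|) :=
    Differentiable.diffContOnCl (by fun_prop)
  have := integral_thetaM (fun ζ : ℂ => inner ℂ p z + ζ * inner ℂ p w) 0 r
  rw [hd.circleAverage] at this
  simp only [zero_mul, add_zero] at this
  have hi : Integrable (fun θ => inner ℂ p z + circleMap 0 r θ * inner ℂ p w) thetaM := by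
    refine Integrable.smul_measure ?_ ENNReal.ofReal_ne_top
    refine (Continuous.integrableOn_Icc (a := 0) (b := 2 * Real.pi) ?_).mono_set
      Ico_subset_Icc_self
    exact continuous_const.add ((continuous_circleMap 0 r).mul continuous_const)
  have h2 := integral_re hi
  simp only [RCLike.re_to_complex] at h2
  simp only [inner_add_right, inner_smul_right]
  rw [h2, this]

lemma pshOnE {U : Set (En n)} (hc : ContinuousOn f U)
    (hm : ∀ z ∈ U, ∀ w : En n, ∀ r : ℝ, 0 < r → (∀ ζ : ℂ, ‖ζ‖ ≤ r → z + ζ • w ∈ U) →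
      f z ≤ ∫ θ, f (z + circleMap 0 r θ • w) ∂thetaM) :
    ContinuousOn (fun x => (f x : EReal)) U ∧ PshOnE (fun x => (f x : EReal)) U := by
  have hc' : ContinuousOn (fun x => (f x : EReal)) U := continuous_coe_real_ereal.comp_continuousOn hc
  refine ⟨hc', hc'.upperSemicontinuousOn, fun z _ => EReal.coe_lt_top _,
    fun z hz w r hr h => ?_⟩
  rw [eint_coe (integrable_thetaM (continuous_comp_circleMap hc hr h))]
  exact EReal.coe_le_coe_iff.2 (hm z hz w r hr h)

end PshNear

lemma integrable_of_continuousOn {n : ℕ} {X : Set (En n)} (hX : IsCompact X) {μ : Measure (En n)}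
    [IsFiniteMeasure μ] (hμ : μ Xᶜ = 0) {f : En n → ℝ} (hf : ContinuousOn f X) :
    Integrable f μ := by
  have h := hf.integrableOn_compact (μ := μ) hX
  rwa [IntegrableOn, Measure.restrict_eq_self_of_ae_mem (mem_ae_iff.2 hμ)] at h

lemma truncation_pshNear {n : ℕ} {X U : Set (En n)} (hU : IsOpen U) (hXU : X ⊆ U)
    {u : En n → EReal} (huc : ContinuousOn u U) (hu : PshOnE u U) (N : ℝ) :
    PshNear X fun x => (max (u x) (N : EReal)).toReal := by
  have hcoe : ∀ x ∈ U, (((max (u x) (N : EReal)).toReal : ℝ) : EReal) = max (u x) N := by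
    intro x hx
    refine EReal.coe_toReal ?_ ?_
    · exact (max_lt (hu.2.1 x hx) (EReal.coe_lt_top _)).ne
    · exact (lt_max_of_lt_right (EReal.bot_lt_coe _)).ne'
  have hcE : ContinuousOn (fun x => max (u x) (N : EReal)) U := huc.sup continuousOn_const
  have hc : ContinuousOn (fun x => (max (u x) (N : EReal)).toReal) U := by
    refine EReal.continuousOn_toReal.comp hcE fun x hx => ?_
    simp only [mem_compl_iff, mem_insert_iff, mem_singleton_iff, not_or]
    exact ⟨(lt_max_of_lt_right (EReal.bot_lt_coe _)).ne',
      (max_lt (hu.2.1 x hx) (EReal.coe_lt_top _)).ne⟩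
  refine ⟨U, hU, hXU, hc, fun z hz w r hr h => ?_⟩
  have hi := integrable_thetaM (continuous_comp_circleMap hc hr h)
  have hmem : ∀ θ, z + circleMap 0 r θ • w ∈ U := fun θ => h _ (by simp [abs_of_pos hr])
  rw [← EReal.coe_le_coe_iff, ← eint_coe hi, hcoe z hz]
  simp only [hcoe _ (hmem _)]
  refine max_le ((hu.2.2 z hz w r hr h).trans (eint_mono (ae_of_all _ fun θ => le_max_left _ _))) ?_
  calc (N : EReal) = eint thetaM (fun _ => (N : EReal)) := by
        rw [eint_coe (integrable_const N)]; simp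
    _ ≤ _ := eint_mono (ae_of_all _ fun θ => le_max_right _ _)

lemma IsJensen.le_integral {n : ℕ} {X : Set (En n)} (hX : IsCompact X) {z : En n}
    {μ : Measure (En n)} (hμ : IsJensen X z μ) {f : En n → ℝ} (hf : PshNear X f) :
    f z ≤ ∫ x, f x ∂μ := by
  have := hμ.1
  have hi := integrable_of_continuousOn hX hμ.2.1 hf.continuousOn
  obtain ⟨U, hU, hXU, hc, hm⟩ := hf
  obtain ⟨h1, h2⟩ := PshNear.pshOnE hc hm
  have := hμ.2.2 U hU hXU _ h1 h2
  rwa [eint_coe hi, EReal.coe_le_coe_iff] at this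

lemma tendsto_toENNReal_min (y : EReal) :
    Tendsto (fun N : ℕ => (min y (N : ℝ)).toENNReal) atTop (𝓝 y.toENNReal) := by
  induction y with
  | bot => simp
  | top =>
    simp only [le_top, inf_of_le_right, EReal.real_coe_toENNReal, ENNReal.ofReal_natCast,
      EReal.toENNReal_top]
    exact ENNReal.tendsto_nat_nhds_top
  | coe y =>
    refine tendsto_const_nhds.congr' ?_
    obtain ⟨N, hN⟩ := exists_nat_ge y
    filter_upwards [eventually_ge_atTop N] with M hM
    rw [min_eq_left]
    exact EReal.coe_le_coe_iff.2 (hN.trans (by exact_mod_cast hM))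

lemma isJensen_of_le_integral {n : ℕ} {X : Set (En n)} (hX : IsCompact X) {z : En n} (hz : z ∈ X)
    {μ : Measure (En n)} [IsProbabilityMeasure μ] (hμ : μ Xᶜ = 0)
    (h : ∀ f, PshNear X f → f z ≤ ∫ x, f x ∂μ) : IsJensen X z μ := by
  refine ⟨inferInstance, hμ, fun U hU hXU u huc hu => ?_⟩
  have hae : ∀ᵐ x ∂μ, x ∈ X := mem_ae_iff.2 hμ
  have hum : AEMeasurable u μ := by
    have := huc.aemeasurable (μ := μ) hU.measurableSet
    rwa [Measure.restrict_eq_self_of_ae_mem (hae.mono fun x hx => hXU hx)] at this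
  have hP : ∫⁻ x, epos (u x) ∂μ ≠ ⊤ := by
    obtain ⟨p, hp, hmax⟩ := hX.exists_isMaxOn ⟨z, hz⟩ (huc.mono hXU)
    have h1 : ∫⁻ x, epos (u x) ∂μ ≤ ∫⁻ _, epos (u p) ∂μ :=
      lintegral_mono_ae (hae.mono fun x hx => EReal.toENNReal_le_toENNReal (hmax hx))
    refine ne_top_of_le_ne_top ?_ h1
    simpa [epos_eq_toENNReal] using (hu.2.1 p (hXU hp)).ne
  have hN : ∀ N : ℕ, u z ≤ ((∫⁻ x, epos (u x) ∂μ : ℝ≥0∞) : EReal) -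
      ((∫⁻ x, epos (min (-u x) (N : ℝ)) ∂μ : ℝ≥0∞) : EReal) := by
    intro N
    have hps := truncation_pshNear hU hXU huc hu (-(N : ℝ))
    have hi := integrable_of_continuousOn hX hμ hps.continuousOn
    have key := h _ hps
    rw [← EReal.coe_le_coe_iff, ← eint_coe hi] at key
    have hcoe : ∀ x ∈ X, (((max (u x) ((-(N : ℝ) : ℝ) : EReal)).toReal : ℝ) : EReal)
        = max (u x) ((-(N : ℝ) : ℝ) : EReal) := by
      intro x hx
      refine EReal.coe_toReal ?_ ?_
      · exact (max_lt (hu.2.1 x (hXU hx)) (EReal.coe_lt_top _)).ne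
      · exact (lt_max_of_lt_right (EReal.bot_lt_coe _)).ne'
    rw [hcoe z hz] at key
    refine (le_max_left _ _).trans (key.trans (le_of_eq ?_))
    unfold eint
    congr 2
    · refine lintegral_congr_ae (hae.mono fun x hx => ?_)
      simp only [hcoe x hx, epos_eq_toENNReal]
      rcases le_total (u x) ((-(N : ℝ) : ℝ) : EReal) with hle | hle
      · have h0 : ((-(N : ℝ) : ℝ) : EReal) ≤ 0 := by
          rw [← EReal.coe_zero, EReal.coe_le_coe_iff]; simp
        rw [max_eq_right hle, EReal.toENNReal_of_nonpos h0,
          EReal.toENNReal_of_nonpos (hle.trans h0)]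
      · rw [max_eq_left hle]
    · refine lintegral_congr_ae (hae.mono fun x hx => ?_)
      simp only [hcoe x hx]
      congr 1
      rw [EReal.coe_neg]
      rcases le_total (u x) (-((N : ℝ) : EReal)) with hle | hle
      · rw [max_eq_right hle, neg_neg, min_eq_right (EReal.le_neg_of_le_neg hle)]
      · rw [max_eq_left hle, min_eq_left (EReal.neg_le_of_neg_le hle)]
  have hlim : Tendsto (fun N : ℕ => ∫⁻ x, epos (min (-u x) (N : ℝ)) ∂μ) atTop
      (𝓝 (∫⁻ x, epos (-u x) ∂μ)) := by
    refine lintegral_tendsto_of_tendsto_of_monotone (fun N => ?_) (ae_of_all _ fun x => ?_)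
      (ae_of_all _ fun x => tendsto_toENNReal_min _)
    · exact (hum.neg.min aemeasurable_const).ereal_toENNReal
    · intro N M hNM
      refine EReal.toENNReal_le_toENNReal (min_le_min_left _ ?_)
      exact EReal.coe_le_coe_iff.2 (by exact_mod_cast hNM)
  have hlim' := EReal.continuous_coe_ennreal_iff.2 continuous_id |>.tendsto _ |>.comp hlim
  refine ge_of_tendsto' (x := atTop) (f := fun N : ℕ => ((∫⁻ x, epos (u x) ∂μ : ℝ≥0∞) : EReal) -
      ((∫⁻ x, epos (min (-u x) (N : ℝ)) ∂μ : ℝ≥0∞) : EReal)) ?_ hN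
  simp only [sub_eq_add_neg, eint]
  have hadd : ContinuousAt (fun p : EReal × EReal => p.1 + p.2)
      (((∫⁻ x, epos (u x) ∂μ : ℝ≥0∞) : EReal), -((∫⁻ x, epos (-u x) ∂μ : ℝ≥0∞) : EReal)) :=
    EReal.continuousAt_add (Or.inl (by simpa using hP)) (Or.inl (EReal.coe_ennreal_ne_bot _))
  exact hadd.tendsto.comp
    (tendsto_const_nhds.prodMk_nhds ((continuous_neg.tendsto _).comp hlim'))

lemma Oset_subset {n : ℕ} (X : Set (En n)) : Oset X ⊆ X := fun _ hz => hz.1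

lemma Bset_subset {n : ℕ} {X : Set (En n)} (hX : IsCompact X) : Bset X ⊆ X :=
  closure_minimal (Oset_subset X) hX.isClosed

lemma isCompact_Bset {n : ℕ} {X : Set (En n)} (hX : IsCompact X) : IsCompact (Bset X) :=
  hX.of_isClosed_subset isClosed_closure (Bset_subset hX)

/-- A measure whose barycenter has the largest norm on a carrier of the measure is a Dirac mass. -/
lemma eq_dirac_of_norm_le {n : ℕ} {X : Set (En n)} (hX : IsCompact X) {p : En n}
    {μ : Measure (En n)} (hμ : IsJensen X p μ) (hle : ∀ᵐ x ∂μ, ‖x‖ ≤ ‖p‖) :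
    μ = Measure.dirac p := by
  have := hμ.1
  have hre := hμ.le_integral hX (PshNear.re_inner p)
  have hp : (inner ℂ p p).re = ‖p‖ ^ 2 := by
    have := inner_self_eq_norm_sq (𝕜 := ℂ) p
    simpa using this
  rw [hp] at hre
  have hi1 : Integrable (fun x : En n => (inner ℂ p x).re) μ :=
    integrable_of_continuousOn hX hμ.2.1 (by fun_prop)
  have hi2 : Integrable (fun x : En n => ‖x - p‖ ^ 2) μ :=
    integrable_of_continuousOn hX hμ.2.1 (by fun_prop)
  have hi3 : Integrable (fun x : En n => 2 * ‖p‖ ^ 2 - 2 * (inner ℂ p x).re) μ :=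
    (integrable_const _).sub (hi1.const_mul 2)
  have hbound : ∫ x, ‖x - p‖ ^ 2 ∂μ ≤ 0 := by
    calc ∫ x, ‖x - p‖ ^ 2 ∂μ ≤ ∫ x, (2 * ‖p‖ ^ 2 - 2 * (inner ℂ p x).re) ∂μ := by
          refine integral_mono_ae hi2 hi3 (hle.mono fun x hx => ?_)
          have h1 := norm_sub_sq (𝕜 := ℂ) x p
          have h2 : RCLike.re (inner ℂ x p) = (inner ℂ p x).re := inner_re_symm (𝕜 := ℂ) x p
          have h3 : ‖x‖ ^ 2 ≤ ‖p‖ ^ 2 := pow_le_pow_left₀ (norm_nonneg _) hx 2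
          simp only [h1, h2]
          linarith
      _ = 2 * ‖p‖ ^ 2 - 2 * ∫ x, (inner ℂ p x).re ∂μ := by
          rw [integral_sub (integrable_const _) (hi1.const_mul 2)]
          simp [integral_const_mul]
      _ ≤ 0 := by linarith
  have hzero : ∫ x, ‖x - p‖ ^ 2 ∂μ = 0 :=
    le_antisymm hbound (integral_nonneg fun x => by positivity)
  have hae : ∀ᵐ x ∂μ, x = p := by
    have := (integral_eq_zero_iff_of_nonneg (fun x => by positivity) hi2).1 hzero
    refine this.mono fun x hx => ?_
    simpa [sub_eq_zero] using hx
  have hmap : μ.map id = μ.map fun _ => p := Measure.map_congr hae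
  simpa using hmap

lemma PshNear.exists_mem_Oset_isMaxOn {n : ℕ} {X : Set (En n)} (hX : IsCompact X)
    (hne : X.Nonempty) {f : En n → ℝ} (hf : PshNear X f) : ∃ p ∈ Oset X, IsMaxOn f X p := by
  obtain ⟨q, hq, hmax⟩ := hX.exists_isMaxOn hne hf.continuousOn
  have hF : IsCompact (X ∩ f ⁻¹' Ici (f q)) :=
    hX.of_isClosed_subset (hf.continuousOn.preimage_isClosed_of_isClosed hX.isClosed isClosed_Ici)
      inter_subset_left
  obtain ⟨p, hp, hpmax⟩ := hF.exists_isMaxOn ⟨q, hq, le_refl (f q)⟩ continuous_norm.continuousOn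
  have hpq : f q ≤ f p := hp.2
  refine ⟨p, ⟨hp.1, fun μ hμ => eq_dirac_of_norm_le hX hμ ?_⟩, fun x hx => (hmax hx).trans hpq⟩
  have := hμ.1
  have hae : ∀ᵐ x ∂μ, x ∈ X := mem_ae_iff.2 hμ.2.1
  have hi := integrable_of_continuousOn hX hμ.2.1 hf.continuousOn
  have hnn : 0 ≤ᵐ[μ] fun x => f q - f x := hae.mono fun x hx => sub_nonneg.2 (hmax hx)
  have hint : ∫ x, (f q - f x) ∂μ = 0 := by
    refine le_antisymm ?_ (integral_nonneg_of_ae hnn)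
    rw [integral_sub (integrable_const _) hi]
    have := hμ.le_integral hX hf
    simp only [integral_const, probReal_univ, smul_eq_mul, one_mul]
    linarith
  have hz := (integral_eq_zero_iff_of_nonneg_ae hnn ((integrable_const _).sub hi)).1 hint
  filter_upwards [hae, hz] with x hx hx0
  have hx0' : f q - f x = 0 := hx0
  exact hpmax ⟨hx, show f q ≤ f x by linarith⟩

/-- The infimum of the values at `z` of the functions `-f`, with `f` continuous and
plurisubharmonic near `X`, that dominate `φ` on `B_X`. -/
noncomputable def upperEnv {n : ℕ} (X : Set (En n)) (z : En n) (φ : C(Bset X, ℝ)) : ℝ :=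
  sInf {t : ℝ | ∃ f : En n → ℝ, PshNear X f ∧ (∀ x : Bset X, φ x ≤ -f x) ∧ t = -f z}

section upperEnv

variable {n : ℕ} {X : Set (En n)}

lemma PshNear.le_neg_of_forall_Bset (hX : IsCompact X) {z : En n} (hz : z ∈ X) {f : En n → ℝ}
    (hf : PshNear X f) {c : ℝ} (h : ∀ x : Bset X, c ≤ -f x) : c ≤ -f z := by
  obtain ⟨p, hp, hmax⟩ := hf.exists_mem_Oset_isMaxOn hX ⟨z, hz⟩
  have h1 := h ⟨p, subset_closure hp⟩
  have h2 : f z ≤ f p := hmax hz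
  simp only at h1
  linarith

lemma exists_forall_abs_le (hX : IsCompact X) (φ : C(Bset X, ℝ)) : ∃ C : ℝ, ∀ x, |φ x| ≤ C := by
  have := isCompact_iff_compactSpace.1 (isCompact_Bset hX)
  exact ⟨‖φ‖, fun x => φ.norm_coe_le_norm x⟩

lemma upperEnv_le (hX : IsCompact X) {z : En n} (hz : z ∈ X) {φ : C(Bset X, ℝ)} {f : En n → ℝ}
    (hf : PshNear X f) (h : ∀ x : Bset X, φ x ≤ -f x) : upperEnv X z φ ≤ -f z := by
  obtain ⟨C, hC⟩ := exists_forall_abs_le hX φ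
  refine csInf_le ⟨-C, ?_⟩ ⟨f, hf, h, rfl⟩
  rintro _ ⟨g, hg, hgφ, rfl⟩
  exact hg.le_neg_of_forall_Bset hX hz fun x => (neg_le_of_abs_le (hC x)).trans (hgφ x)

lemma le_upperEnv (hX : IsCompact X) {z : En n} {φ : C(Bset X, ℝ)} {c : ℝ}
    (h : ∀ f : En n → ℝ, PshNear X f → (∀ x : Bset X, φ x ≤ -f x) → c ≤ -f z) :
    c ≤ upperEnv X z φ := by
  obtain ⟨C, hC⟩ := exists_forall_abs_le hX φ
  refine le_csInf ⟨_, fun _ => -C, PshNear.const _, fun x => ?_, rfl⟩ ?_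
  · simpa using (le_abs_self _).trans (hC x)
  · rintro _ ⟨g, hg, hgφ, rfl⟩
    exact h g hg hgφ

lemma exists_lt_of_upperEnv_lt (hX : IsCompact X) {z : En n} {φ : C(Bset X, ℝ)} {c : ℝ}
    (h : upperEnv X z φ < c) :
    ∃ f : En n → ℝ, PshNear X f ∧ (∀ x : Bset X, φ x ≤ -f x) ∧ -f z < c := by
  by_contra! hcon
  exact h.not_ge (le_upperEnv hX hcon)

lemma upperEnv_smul_le (hX : IsCompact X) {z : En n} (hz : z ∈ X) {c : ℝ} (hc : 0 < c)
    (φ : C(Bset X, ℝ)) : c * upperEnv X z φ ≤ upperEnv X z (c • φ) := by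
  refine le_upperEnv hX fun f hf h => ?_
  have := upperEnv_le hX hz (φ := φ) (hf.const_mul (inv_pos.2 hc).le) fun x => by
    have h1 : c * φ x ≤ -f x := h x
    rw [← mul_neg, le_inv_mul_iff₀ hc]
    exact h1
  rwa [← mul_neg, le_inv_mul_iff₀ hc] at this

lemma upperEnv_smul (hX : IsCompact X) {z : En n} (hz : z ∈ X) {c : ℝ} (hc : 0 < c)
    (φ : C(Bset X, ℝ)) : upperEnv X z (c • φ) = c * upperEnv X z φ := by
  refine le_antisymm ?_ (upperEnv_smul_le hX hz hc φ)
  have := upperEnv_smul_le hX hz (inv_pos.2 hc) (c • φ)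
  rwa [smul_smul, inv_mul_cancel₀ hc.ne', one_smul, inv_mul_le_iff₀ hc] at this

lemma upperEnv_add_le (hX : IsCompact X) {z : En n} (hz : z ∈ X) (φ ψ : C(Bset X, ℝ)) :
    upperEnv X z (φ + ψ) ≤ upperEnv X z φ + upperEnv X z ψ := by
  refine le_of_forall_pos_lt_add fun ε hε => ?_
  obtain ⟨f, hf, hfφ, hfz⟩ := exists_lt_of_upperEnv_lt hX
    (show upperEnv X z φ < upperEnv X z φ + ε / 2 by linarith)
  obtain ⟨g, hg, hgψ, hgz⟩ := exists_lt_of_upperEnv_lt hX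
    (show upperEnv X z ψ < upperEnv X z ψ + ε / 2 by linarith)
  have := upperEnv_le hX hz (φ := φ + ψ) (hf.add hg) fun x => by
    have h1 := hfφ x
    have h2 := hgψ x
    simp only [ContinuousMap.add_apply]
    linarith
  linarith

end upperEnv

/-- A sublinear functional is supported at each point by a linear functional. -/
lemma exists_linearMap_eq_and_le {E : Type*} [AddCommGroup E] [Module ℝ E] (N : E → ℝ)
    (hsmul : ∀ c : ℝ, 0 < c → ∀ x, N (c • x) = c * N x)
    (hadd : ∀ x y, N (x + y) ≤ N x + N y) (x : E) :
    ∃ g : E →ₗ[ℝ] ℝ, g x = N x ∧ ∀ y, g y ≤ N y := by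
  have h0 : N 0 = 0 := by
    have := hsmul 2 two_pos 0
    rw [smul_zero] at this
    linarith
  have H : ∀ c : ℝ, c • x = 0 → (RingHom.id ℝ) c • N x = 0 := by
    intro c hc
    rcases smul_eq_zero.1 hc with rfl | rfl
    · simp
    · simp [h0]
  obtain ⟨g, hg, hgN⟩ := exists_extension_of_le_sublinear
    (LinearPMap.mkSpanSingleton' x (N x) H) N hsmul hadd (by
      rintro ⟨y, hy⟩
      obtain ⟨c, rfl⟩ := Submodule.mem_span_singleton.1 hy
      rw [LinearPMap.mkSpanSingleton'_apply, smul_eq_mul]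
      rcases lt_trichotomy c 0 with hc | rfl | hc
      · have h1 := hsmul (-c) (neg_pos.2 hc) x
        have h2 := hadd (c • x) ((-c) • x)
        rw [← add_smul, add_neg_cancel, zero_smul, h0, h1] at h2
        show c * N x ≤ N (c • x)
        linarith
      · simp [h0]
      · exact (hsmul c hc x).ge)
  refine ⟨g, ?_, hgN⟩
  have hx : (1 : ℝ) • x ∈ (LinearPMap.mkSpanSingleton' x (N x) H).domain :=
    Submodule.smul_mem _ _ (Submodule.mem_span_singleton_self x)
  have := hg ⟨(1 : ℝ) • x, hx⟩
  rw [LinearPMap.mkSpanSingleton'_apply] at this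
  simpa using this

/-- A positive linear functional on the continuous functions of a compact space is integration
against a finite measure. -/
lemma exists_measure_of_nonneg {K : Type*} [TopologicalSpace K] [CompactSpace K] [T2Space K]
    [MeasurableSpace K] [BorelSpace K] (L : C(K, ℝ) →ₗ[ℝ] ℝ) (hL : ∀ φ, 0 ≤ φ → 0 ≤ L φ) :
    ∃ ν : Measure K, IsFiniteMeasure ν ∧ ∀ φ : C(K, ℝ), ∫ x, φ x ∂ν = L φ := by
  let T : CompactlySupportedContinuousMap K ℝ →ₗ[ℝ] ℝ :=
    { toFun := fun f => L f.toContinuousMap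
      map_add' := fun f g => L.map_add _ _
      map_smul' := fun c f => L.map_smul _ _ }
  let Λ := PositiveLinearMap.mk₀ T fun f hf => hL _ hf
  refine ⟨RealRMK.rieszMeasure Λ, inferInstance, fun φ => ?_⟩
  exact RealRMK.integral_rieszMeasure Λ (CompactlySupportedContinuousMap.continuousMapEquiv φ)

lemma exists_isJensenB_integral_eq {n : ℕ} {X : Set (En n)} (hX : IsCompact X) {z : En n}
    (hz : z ∈ X) (φ : C(Bset X, ℝ)) : ∃ μ : Measure (En n), IsJensenB X z μ ∧
      ∀ Φ : En n → ℝ, (∀ x : Bset X, Φ x = φ x) → ∫ x, Φ x ∂μ = upperEnv X z φ := by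
  have hBc := isCompact_Bset hX
  have := isCompact_iff_compactSpace.1 hBc
  obtain ⟨L, hLφ, hL⟩ := exists_linearMap_eq_and_le (upperEnv X z)
    (fun c hc φ => upperEnv_smul hX hz hc φ) (upperEnv_add_le hX hz) φ
  have hpos : ∀ ψ, 0 ≤ ψ → 0 ≤ L ψ := by
    intro ψ hψ
    have h1 := hL (-ψ)
    have h2 := upperEnv_le hX hz (φ := -ψ) (PshNear.const 0) fun x => by simpa using hψ x
    rw [map_neg] at h1
    simp only [neg_zero] at h2
    linarith
  obtain ⟨ν, hν, hνL⟩ := exists_measure_of_nonneg L hpos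
  have hpsh : ∀ f, PshNear X f → f z ≤ ∫ x : Bset X, f x ∂ν := by
    intro f hf
    let F : C(Bset X, ℝ) :=
      ⟨fun x => f x, (hf.continuousOn.mono (Bset_subset hX)).domRestrict⟩
    have h1 := hL (-F)
    have h2 := upperEnv_le hX hz (φ := -F) hf fun x => le_rfl
    rw [map_neg] at h1
    have h3 : ∫ x : Bset X, f x ∂ν = L F := hνL F
    linarith
  have hprob : IsProbabilityMeasure ν := by
    have h1 := hpsh _ (PshNear.const 1)
    have h2 := hpsh _ (PshNear.const (-1))
    simp only [integral_const, smul_eq_mul, mul_one, mul_neg] at h1 h2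
    have h3 : ν.real univ = 1 := by linarith
    exact ⟨by simpa [measureReal_def, ENNReal.toReal_eq_one_iff] using h3⟩
  have hemb : MeasurableEmbedding ((↑) : Bset X → En n) :=
    MeasurableEmbedding.subtype_coe hBc.measurableSet
  have hμB : (ν.map ((↑) : Bset X → En n)) (Bset X)ᶜ = 0 := by
    rw [hemb.map_apply]
    simp
  have : IsProbabilityMeasure (ν.map ((↑) : Bset X → En n)) :=
    Measure.isProbabilityMeasure_map hemb.measurable.aemeasurable
  refine ⟨ν.map (↑), ⟨isJensen_of_le_integral hX hz ?_ fun f hf => ?_, hμB⟩, fun Φ hΦ => ?_⟩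
  · exact measure_mono_null (compl_subset_compl.2 (Bset_subset hX)) hμB
  · rw [hemb.integral_map]
    exact hpsh f hf
  · rw [hemb.integral_map]
    simp only [hΦ]
    rw [hνL, hLφ]

lemma existsUnique_isJensenB_of_poissonSet {n : ℕ} {X : Set (En n)} (hX : IsCompact X)
    (hP : PoissonSet X) {z : En n} (hz : z ∈ X) : ∃! μ : Measure (En n), IsJensenB X z μ := by
  obtain ⟨μ, hμ, -⟩ := exists_isJensenB_integral_eq hX hz 0
  refine ⟨μ, hμ, fun ν hν => ?_⟩
  have := hμ.1.1
  have := hν.1.1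
  refine ext_of_forall_integral_eq_of_IsFiniteMeasure fun f => ?_
  obtain ⟨h, hh, hhf⟩ := hP f f.continuous.continuousOn
  have key : ∀ ρ : Measure (En n), IsJensenB X z ρ → ∫ x, f x ∂ρ = h z := by
    intro ρ hρ
    have := hρ.1.1
    have h1 := hh.2 z hz ρ hρ.1
    rw [eint_coe (integrable_of_continuousOn hX hρ.1.2.1 hh.1), EReal.coe_eq_coe_iff] at h1
    rw [h1]
    have hae : ∀ᵐ x ∂ρ, x ∈ Bset X := mem_ae_iff.2 hρ.2
    exact integral_congr_ae (hae.mono fun x hx => (hhf x hx).symm)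
  rw [key ν hν, key μ hμ]

lemma isJensen_dirac {n : ℕ} {X : Set (En n)} (hX : IsCompact X) {z : En n} (hz : z ∈ X) :
    IsJensen X z (Measure.dirac z) :=
  isJensen_of_le_integral hX hz (by simp [Measure.dirac_apply' _ hX.measurableSet.compl, hz])
    fun f _ => by simp

lemma poissonSet_of_existsUnique {n : ℕ} {X : Set (En n)} (hX : IsCompact X)
    (hu : ∀ z ∈ X, ∃! μ : Measure (En n), IsJensenB X z μ) : PoissonSet X := by
  intro Φ hΦ
  let φ : C(Bset X, ℝ) := ⟨(Bset X).domRestrict Φ, hΦ.domRestrict⟩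
  have hneg : ∀ z ∈ X, upperEnv X z (-φ) = -upperEnv X z φ := by
    intro z hz
    obtain ⟨μ, hμ, h1⟩ := exists_isJensenB_integral_eq hX hz φ
    obtain ⟨ν, hν, h2⟩ := exists_isJensenB_integral_eq hX hz (-φ)
    rw [(hu z hz).unique hν hμ] at h2
    rw [← h1 Φ fun x => rfl, ← h2 (fun x => -Φ x) fun x => rfl, integral_neg]
  have husc : ∀ ψ : C(Bset X, ℝ), ∀ z ∈ X, ∀ c, upperEnv X z ψ < c →
      ∀ᶠ x in 𝓝[X] z, upperEnv X x ψ < c := by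
    intro ψ z hz c hc
    obtain ⟨f, hf, hfψ, hfz⟩ := exists_lt_of_upperEnv_lt hX hc
    filter_upwards [(hf.continuousOn.neg z hz).eventually_lt_const hfz, self_mem_nhdsWithin]
      with x hx hxX
    exact (upperEnv_le hX hxX hf hfψ).trans_lt hx
  have hcont : ContinuousOn (fun z => upperEnv X z φ) X := by
    intro z hz
    refine tendsto_order.2 ⟨fun c hc => ?_, fun c hc => husc φ z hz c hc⟩
    have := husc (-φ) z hz (-c) (by rw [hneg z hz]; exact neg_lt_neg hc)
    filter_upwards [this, self_mem_nhdsWithin] with x hx hxX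
    rw [hneg x hxX] at hx
    exact neg_lt_neg_iff.1 hx
  have hcont' : ContinuousOn (fun z => upperEnv X z (-φ)) X :=
    hcont.neg.congr fun z hz => hneg z hz
  have hint : ∀ ψ : C(Bset X, ℝ), ContinuousOn (fun z => upperEnv X z ψ) X → ∀ z ∈ X,
      ∀ μ, IsJensen X z μ → ∫ x, upperEnv X x ψ ∂μ ≤ upperEnv X z ψ := by
    intro ψ hψ z hz μ hμ
    have := hμ.1
    refine le_upperEnv hX fun f hf hfψ => ?_
    have hae : ∀ᵐ x ∂μ, x ∈ X := mem_ae_iff.2 hμ.2.1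
    have hle : ∫ x, upperEnv X x ψ ∂μ ≤ ∫ x, -f x ∂μ :=
      integral_mono_ae (integrable_of_continuousOn hX hμ.2.1 hψ)
        (integrable_of_continuousOn hX hμ.2.1 hf.continuousOn.neg)
        (hae.mono fun x hx => upperEnv_le hX hx hf hfψ)
    rw [integral_neg] at hle
    have := hμ.le_integral hX hf
    linarith
  refine ⟨fun z => upperEnv X z φ, ⟨hcont, fun z hz μ hμ => ?_⟩, fun w hw => ?_⟩
  · have := hμ.1
    rw [eint_coe (integrable_of_continuousOn hX hμ.2.1 hcont), EReal.coe_eq_coe_iff]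
    refine le_antisymm ?_ (hint φ hcont z hz μ hμ)
    have h1 := hint (-φ) hcont' z hz μ hμ
    have hae : ∀ᵐ x ∂μ, x ∈ X := mem_ae_iff.2 hμ.2.1
    rw [hneg z hz, integral_congr_ae (hae.mono fun x hx => hneg x hx), integral_neg] at h1
    linarith
  · have hwX := Bset_subset hX hw
    obtain ⟨μ, hμ, h1⟩ := exists_isJensenB_integral_eq hX hwX φ
    have hd : IsJensenB X w (Measure.dirac w) :=
      ⟨isJensen_dirac hX hwX,
        by simp [Measure.dirac_apply' _ (isCompact_Bset hX).measurableSet.compl, hw]⟩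
    change upperEnv X w φ = Φ w
    rw [← h1 Φ fun x => rfl, (hu w hwX).unique hμ hd]
    simp

/-- Theorem 5.1: `X` is a Poisson set iff each `J_z^b(X)` is a singleton. -/
theorem stmt_11 {n : ℕ} (X : Set (En n)) (hX : IsCompact X) :
    PoissonSet X ↔ ∀ z ∈ X, ∃! μ : Measure (En n), IsJensenB X z μ := by
  exact ⟨fun hP z hz => existsUnique_isJensenB_of_poissonSet hX hP hz,
    poissonSet_of_existsUnique hX⟩
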